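/- Let H be a real Hilbert space, f : H → ℝ ∪ {+∞} a proper, convex, lower semicontinuous function, and g : H → ℝ a convex Fréchet differentiable function whose gradient ∇g is L_g-Lipschitz continuous (L_g > 0). Then for every s with 0 < s ≤ 1/L_g and all x, y ∈ H, writing P = prox_{sf}(y − s∇g(y)): (f+g)(P) ≤ (f+g)(x) − (1/s)⟨y − P, x − y⟩ − (1/(2s))‖P − y‖² − (s/2)‖∇g(y) − ∇g(x)‖². -/

import Mathlib

open Filter Topology
open scoped RealInnerProductSpace

section ProxDescent

variable {H : Type*} [NormedAddCommGroup H] [InnerProductSpace ℝ H]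

theorem HasGradientAt.hasDerivAt_comp_line [CompleteSpace H] {g : H → ℝ} {p v d : H} {t : ℝ}
    (h : HasGradientAt g p (v + t • d)) :
    HasDerivAt (fun r : ℝ => g (v + r • d)) ⟪p, d⟫ t := by
  have hline : HasDerivAt (fun r : ℝ => v + r • d) d t := by
    simpa using ((hasDerivAt_id t).smul_const d).const_add v
  exact h.hasFDerivAt.comp_hasDerivAt t hline

/-- The descent lemma for functions with an `L`-Lipschitz gradient. -/
theorem le_add_inner_add_sq_of_lipschitz_gradient [CompleteSpace H] {g : H → ℝ} {g' : H → H}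
    {L : ℝ} (hg : ∀ u, HasGradientAt g (g' u) u)
    (hlip : ∀ u v, ‖g' u - g' v‖ ≤ L * ‖u - v‖) (v w : H) :
    g w ≤ g v + ⟪g' v, w - v⟫ + L / 2 * ‖w - v‖ ^ 2 := by
  set d := w - v with hd
  have hderiv (t : ℝ) : HasDerivAt
      (fun r : ℝ => g (v + r • d) - r * ⟪g' v, d⟫ - r ^ 2 * (L / 2 * ‖d‖ ^ 2))
      (⟪g' (v + t • d), d⟫ - ⟪g' v, d⟫ - 2 * t * (L / 2 * ‖d‖ ^ 2)) t := by
    have hlin : HasDerivAt (fun r : ℝ => r * ⟪g' v, d⟫) ⟪g' v, d⟫ t := by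
      simpa using (hasDerivAt_id t).mul_const ⟪g' v, d⟫
    have hsq : HasDerivAt (fun r : ℝ => r ^ 2 * (L / 2 * ‖d‖ ^ 2))
        (2 * t * (L / 2 * ‖d‖ ^ 2)) t := by
      simpa using (hasDerivAt_pow 2 t).mul_const (L / 2 * ‖d‖ ^ 2)
    exact ((hg (v + t • d)).hasDerivAt_comp_line.sub hlin).sub hsq
  have hanti : AntitoneOn
      (fun r : ℝ => g (v + r • d) - r * ⟪g' v, d⟫ - r ^ 2 * (L / 2 * ‖d‖ ^ 2))
      (Set.Icc 0 1) := by
    refine antitoneOn_of_deriv_nonpos (convex_Icc 0 1)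
      (fun t _ => (hderiv t).continuousAt.continuousWithinAt)
      (fun t _ => (hderiv t).differentiableAt.differentiableWithinAt) fun t ht => ?_
    rw [interior_Icc] at ht
    rw [(hderiv t).deriv]
    have hinner := real_inner_le_norm (g' (v + t • d) - g' v) d
    have hbound := hlip (v + t • d) v
    rw [add_sub_cancel_left, norm_smul, Real.norm_of_nonneg ht.1.le] at hbound
    have hmul := mul_le_mul_of_nonneg_right hbound (norm_nonneg d)
    rw [inner_sub_left] at hinner
    linarith
  have h01 := hanti (Set.left_mem_Icc.2 zero_le_one) (Set.right_mem_Icc.2 zero_le_one)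
    (zero_le_one' ℝ)
  have hw : v + d = w := by rw [hd]; abel
  simp only [one_smul, zero_smul, add_zero, hw] at h01
  linarith

theorem ConvexOn.add_inner_gradient_le [CompleteSpace H] {g : H → ℝ} {p v : H}
    (hconv : ConvexOn ℝ Set.univ g) (hg : HasGradientAt g p v) (w : H) :
    g v + ⟪p, w - v⟫ ≤ g w := by
  have hline : ConvexOn ℝ Set.univ (fun r : ℝ => g (v + r • (w - v))) := by
    have h := hconv.comp_affineMap (AffineMap.lineMap v w : ℝ →ᵃ[ℝ] H)
    simpa [Function.comp_def, AffineMap.lineMap_apply, add_comm] using h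
  have hderiv : HasDerivAt (fun r : ℝ => g (v + r • (w - v))) ⟪p, w - v⟫ 0 :=
    HasGradientAt.hasDerivAt_comp_line (by simpa using hg)
  have hslope := hline.le_slope_of_hasDerivAt (Set.mem_univ 0) (Set.mem_univ 1) one_pos hderiv
  simp [slope_def_field] at hslope
  linarith

/-- A convex function with an `s⁻¹`-Lipschitz gradient lies above its tangents by at least a
multiple of the squared distance between gradients. -/
theorem ConvexOn.add_inner_gradient_add_sq_le [CompleteSpace H] {g : H → ℝ} {g' : H → H} {s : ℝ}
    (hs : 0 < s) (hconv : ConvexOn ℝ Set.univ g) (hg : ∀ u, HasGradientAt g (g' u) u)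
    (hlip : ∀ u v, ‖g' u - g' v‖ ≤ 1 / s * ‖u - v‖) (x y : H) :
    g y + ⟪g' y, x - y⟫ + s / 2 * ‖g' y - g' x‖ ^ 2 ≤ g x := by
  set e := g' y - g' x with he
  have hlower := hconv.add_inner_gradient_le (hg y) (x + s • e)
  have hupper := le_add_inner_add_sq_of_lipschitz_gradient hg hlip x (x + s • e)
  rw [add_sub_right_comm, inner_add_right, inner_smul_right] at hlower
  rw [add_sub_cancel_left, inner_smul_right, norm_smul, Real.norm_of_nonneg hs.le,
    show 1 / s / 2 * (s * ‖e‖) ^ 2 = s / 2 * ‖e‖ ^ 2 by field_simp] at hupper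
  have hsq : ⟪g' y, e⟫ - ⟪g' x, e⟫ = ‖e‖ ^ 2 := by
    rw [← inner_sub_left, ← he, real_inner_self_eq_norm_sq]
  have hmul : s * ⟪g' y, e⟫ - s * ⟪g' x, e⟫ = s * ‖e‖ ^ 2 := by rw [← mul_sub, hsq]
  linarith

/-- The variational inequality satisfied by a proximal point `P` of a convex function at `z`. -/
theorem prox_variational_inequality {f : H → EReal}
    (hconv : ∀ u v : H, ∀ a b : ℝ, 0 ≤ a → 0 ≤ b → a + b = 1 →
      f (a • u + b • v) ≤ (a : EReal) * f u + (b : EReal) * f v)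
    {s : ℝ} (hs : 0 < s) {z P x : H}
    (hP : ∀ u : H, f P + ((‖P - z‖ ^ 2 / (2 * s) : ℝ) : EReal)
      ≤ f u + ((‖u - z‖ ^ 2 / (2 * s) : ℝ) : EReal))
    {p a : ℝ} (hfP : f P = p) (hfx : f x = a) :
    p + 1 / s * ⟪z - P, x - P⟫ ≤ a := by
  have hstep : ∀ t ∈ Set.Ioc (0 : ℝ) 1,
      p + 1 / s * ⟪z - P, x - P⟫ ≤ a + t * (‖x - P‖ ^ 2 / (2 * s)) := by
    rintro t ⟨ht, ht1⟩
    have hc := hconv P x (1 - t) t (by linarith) ht.le (by ring)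
    have hmin := (hP ((1 - t) • P + t • x)).trans (add_le_add_left hc _)
    rw [hfP, hfx] at hmin
    norm_cast at hmin
    have hpoint : (1 - t) • P + t • x - z = t • (x - P) - (z - P) := by module
    rw [hpoint, norm_sub_sq_real (t • (x - P)), norm_smul, inner_smul_left, Real.norm_of_nonneg ht.le,
      norm_sub_rev P z, real_inner_comm] at hmin
    simp only [conj_trivial] at hmin
    refine le_of_mul_le_mul_left ?_ ht
    have hexpand : ((t * ‖x - P‖) ^ 2 - 2 * (t * ⟪z - P, x - P⟫) + ‖z - P‖ ^ 2) / (2 * s)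
        = t * (t * (‖x - P‖ ^ 2 / (2 * s))) - t * (1 / s * ⟪z - P, x - P⟫)
          + ‖z - P‖ ^ 2 / (2 * s) := by
      field_simp
    rw [hexpand] at hmin
    linarith
  have hlim : Tendsto (fun t : ℝ => a + t * (‖x - P‖ ^ 2 / (2 * s))) (𝓝[>] 0) (𝓝 a) := by
    have hcont : Continuous fun t : ℝ => a + t * (‖x - P‖ ^ 2 / (2 * s)) := by fun_prop
    simpa using (hcont.tendsto 0).mono_left nhdsWithin_le_nhds
  exact ge_of_tendsto hlim (eventually_of_mem (Ioc_mem_nhdsGT one_pos) hstep)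

end ProxDescent

/-- Extended descent lemma (Lemma A.4, eq. (f6)): for proper convex lsc `f`, convex `g` with
`L_g`-Lipschitz gradient, `0 < s ≤ 1/L_g` and `P = prox_{sf}(y − s∇g(y))`:
`(f+g)(P) ≤ (f+g)(x) − (1/s)⟨y − P, x − y⟩ − (1/(2s))‖P − y‖² − (s/2)‖∇g(y) − ∇g(x)‖²`. -/
theorem prox_descent_lemma_small_step
    {H : Type*} [NormedAddCommGroup H] [InnerProductSpace ℝ H] [CompleteSpace H]
    (f : H → EReal)
    (hf_proper : ∃ z, f z ≠ ⊤) (hf_nebot : ∀ z, f z ≠ ⊥)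
    (hf_convex : ∀ u v : H, ∀ a b : ℝ, 0 ≤ a → 0 ≤ b → a + b = 1 →
      f (a • u + b • v) ≤ (a : EReal) * f u + (b : EReal) * f v)
    (hf_lsc : LowerSemicontinuous f)
    (g : H → ℝ) (g' : H → H) (Lg : ℝ) (hLg : 0 < Lg)
    (hg_convex : ConvexOn ℝ Set.univ g)
    (hg_diff : ∀ u : H, HasGradientAt g (g' u) u)
    (hg_lip : ∀ u v : H, ‖g' u - g' v‖ ≤ Lg * ‖u - v‖)
    (s : ℝ) (hs : 0 < s) (hs' : s ≤ 1 / Lg) (x y : H)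
    -- P = prox_{sf}(y − s∇g(y)) : the minimizer of u ↦ f(u) + ‖u − (y − s∇g(y))‖²/(2s)
    (P : H)
    (hP : ∀ u : H, f P + ((‖P - (y - s • g' y)‖ ^ 2 / (2 * s) : ℝ) : EReal)
        ≤ f u + ((‖u - (y - s • g' y)‖ ^ 2 / (2 * s) : ℝ) : EReal)) :
    f P + (g P : EReal) ≤ f x + (g x : EReal)
      + ((-(1 / s) * ⟪y - P, x - y⟫ - (1 / (2 * s)) * ‖P - y‖ ^ 2
          - s / 2 * ‖g' y - g' x‖ ^ 2 : ℝ) : EReal) := by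
  have hlip : ∀ u v, ‖g' u - g' v‖ ≤ 1 / s * ‖u - v‖ := fun u v =>
    (hg_lip u v).trans
      (mul_le_mul_of_nonneg_right ((le_one_div hs hLg).1 hs') (norm_nonneg _))
  have hfP_top : f P ≠ ⊤ := by
    obtain ⟨z, hz⟩ := hf_proper
    intro htop
    have h := hP z
    rw [htop, EReal.top_add_coe, top_le_iff] at h
    exact EReal.add_ne_top hz (EReal.coe_ne_top _) h
  obtain ⟨p, hp⟩ : ∃ p : ℝ, f P = p := ⟨_, (EReal.coe_toReal hfP_top (hf_nebot P)).symm⟩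
  by_cases hfx_top : f x = ⊤
  · rw [hfx_top, EReal.top_add_coe, EReal.top_add_coe]
    exact le_top
  obtain ⟨a, ha⟩ : ∃ a : ℝ, f x = a := ⟨_, (EReal.coe_toReal hfx_top (hf_nebot x)).symm⟩
  have hprox := prox_variational_inequality hf_convex hs hP hp ha
  have hdescent := le_add_inner_add_sq_of_lipschitz_gradient hg_diff hlip y P
  have htangent := hg_convex.add_inner_gradient_add_sq_le hs hg_diff hlip x y
  rw [hp, ha]
  norm_cast
  have hsplit : 1 / s * ⟪y - s • g' y - P, x - P⟫
      = 1 / s * ⟪y - P, x - y⟫ + 1 / s * ‖P - y‖ ^ 2 - ⟪g' y, x - y⟫ + ⟪g' y, P - y⟫ := by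
    rw [show y - s • g' y - P = (y - P) - s • g' y by abel,
      show x - P = (x - y) - (P - y) by abel, inner_sub_left, inner_smul_left,
      inner_sub_right _ (x - y), inner_sub_right _ (x - y), ← neg_sub P y,
      inner_neg_left _ (P - y), real_inner_self_eq_norm_sq, conj_trivial]
    field_simp
    ring
  have hhalf : 1 / s * ‖P - y‖ ^ 2 = 2 * (1 / (2 * s) * ‖P - y‖ ^ 2) := by field_simp
  have hhalf' : 1 / s / 2 * ‖P - y‖ ^ 2 = 1 / (2 * s) * ‖P - y‖ ^ 2 := by field_simp
  linarith
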